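/- arXiv:1005.3257 — 2 statements merged into one kernel-verified Lean document; each statement's English description precedes it below -/
import Mathlib

section
/- (Theorem of Section 3.3, parts (c) and (d).) For every subset Λ ⊆ {1,…,p} there is an injective K-algebra homomorphism Φ_Λ from the commutative polynomial ring MvPolynomial (Fin n ⊕ Fin p) K in n+p variables to the K-algebra of K-linear endomorphisms of R such that Φ_Λ sends the i-th x-indexed variable to g_i and the j-th t-indexed variable to mul(t_j − f_j) if j ∈ Λ and to σ_j if j ∉ Λ, and whose range is the K-subalgebra Algebra.adjoin K (M_Λ). Consequently the elements of M_Λ are algebraically independent over K, and the K-subalgebra they generate is isomorphic to a commutative polynomial ring in n+p variables (hence of Krull dimension n+p). -/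
open MvPolynomial

variable {K : Type*} [Field K] [CharZero K] {n p : ℕ}

/-- The multiplication-by-`g` endomorphism of `K[x_1,…,x_n,t_1,…,t_p]`. -/
noncomputable def mulOp (g : MvPolynomial (Fin n ⊕ Fin p) K) :
    Module.End K (MvPolynomial (Fin n ⊕ Fin p) K) :=
  LinearMap.mulLeft K g

/-- The partial-derivative endomorphism with respect to the variable `v`. -/
noncomputable def pd (v : Fin n ⊕ Fin p) :
    Module.End K (MvPolynomial (Fin n ⊕ Fin p) K) :=
  (pderiv v).toLinearMap

/-- The operator `g_i = ∂x_i + Σ_j mul(∂f_j/∂x_i) ∘ ∂t_j`. -/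
noncomputable def gOp (f : Fin p → MvPolynomial (Fin n ⊕ Fin p) K) (i : Fin n) :
    Module.End K (MvPolynomial (Fin n ⊕ Fin p) K) :=
  pd (Sum.inl i) + ∑ j : Fin p, mulOp (pderiv (Sum.inl i) (f j)) * pd (Sum.inr j)

/-- The operator `σ_j = mul(f_j − t_j) ∘ ∂t_j − id`, the image of `s_j + f_j ∂t_j`
under the representation sending `s_j` to `−t_j ∂t_j − 1`. -/
noncomputable def sigmaOp (f : Fin p → MvPolynomial (Fin n ⊕ Fin p) K) (j : Fin p) :
    Module.End K (MvPolynomial (Fin n ⊕ Fin p) K) :=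
  mulOp (f j - X (Sum.inr j)) * pd (Sum.inr j) - 1

open Classical in
/-- The family `M_Λ` of `n + p` endomorphisms: `g_1,…,g_n` together with
`mul(t_k − f_k)` for `k ∈ Λ` and `σ_j` for `j ∉ Λ`. -/
noncomputable def MFam (f : Fin p → MvPolynomial (Fin n ⊕ Fin p) K) (Λ : Set (Fin p)) :
    Fin n ⊕ Fin p → Module.End K (MvPolynomial (Fin n ⊕ Fin p) K) :=
  Sum.elim (gOp f) fun j => if j ∈ Λ then mulOp (X (Sum.inr j) - f j) else sigmaOp f j

open scoped IsMulCommutative in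
/-- A family of pairwise commuting elements of a (not necessarily commutative) algebra extends to
an algebra homomorphism from the polynomial ring. -/
theorem exists_algHom_of_commute {R A σ : Type*} [CommRing R] [Ring A] [Algebra R A] (M : σ → A)
    (hM : ∀ a b, Commute (M a) (M b)) :
    ∃ Φ : MvPolynomial σ R →ₐ[R] A, ∀ a, Φ (X a) = M a := by
  have := Algebra.isMulCommutative_adjoin R (s := Set.range M)
    (by rintro _ ⟨a, rfl⟩ _ ⟨b, rfl⟩; exact hM a b)
  let Φ : MvPolynomial σ R →ₐ[R] Algebra.adjoin R (Set.range M) :=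
    aeval (S₁ := Algebra.adjoin R (Set.range M)) fun a => ⟨M a, Algebra.subset_adjoin ⟨a, rfl⟩⟩
  exact ⟨(Algebra.adjoin R (Set.range M)).val.comp Φ, fun a => by simp [Φ]⟩

theorem range_eq_adjoin_of_map_X {R A σ : Type*} [CommRing R] [Ring A] [Algebra R A] {M : σ → A}
    {Φ : MvPolynomial σ R →ₐ[R] A} (hΦ : ∀ a, Φ (X a) = M a) :
    Φ.range = Algebra.adjoin R (Set.range M) := by
  rw [← Algebra.map_top, ← adjoin_range_X, AlgHom.map_adjoin, ← Set.range_comp]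
  congr 2
  exact funext hΦ

omit [CharZero K] in
theorem mulOp_apply (g q : MvPolynomial (Fin n ⊕ Fin p) K) : mulOp g q = g * q := rfl

omit [CharZero K] in
theorem pd_apply (v : Fin n ⊕ Fin p) (q : MvPolynomial (Fin n ⊕ Fin p) K) :
    pd v q = pderiv v q := rfl

omit [CharZero K] in
theorem mulOp_zero : mulOp (0 : MvPolynomial (Fin n ⊕ Fin p) K) = 0 := by
  ext1; simp [mulOp]

omit [CharZero K] in
theorem gOp_apply (f : Fin p → MvPolynomial (Fin n ⊕ Fin p) K) (i : Fin n)
    (q : MvPolynomial (Fin n ⊕ Fin p) K) :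
    gOp f i q = pderiv (Sum.inl i) q
      + ∑ j, pderiv (Sum.inl i) (f j) * pderiv (Sum.inr j) q := by
  simp [gOp, mulOp_apply, pd_apply, LinearMap.sum_apply]

omit [CharZero K] in
theorem gOp_zero (i : Fin n) :
    gOp (0 : Fin p → MvPolynomial (Fin n ⊕ Fin p) K) i = pd (Sum.inl i) := by
  simp [gOp, mulOp_zero]

omit [CharZero K] in
theorem sigmaOp_apply (f : Fin p → MvPolynomial (Fin n ⊕ Fin p) K) (j : Fin p)
    (q : MvPolynomial (Fin n ⊕ Fin p) K) :
    sigmaOp f j q = (f j - X (Sum.inr j)) * pderiv (Sum.inr j) q - q := rfl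

omit [CharZero K] in
theorem MFam_inl (f : Fin p → MvPolynomial (Fin n ⊕ Fin p) K) (Λ : Set (Fin p)) (i : Fin n) :
    MFam f Λ (Sum.inl i) = gOp f i := rfl

omit [CharZero K] in
theorem MFam_inr_of_mem (f : Fin p → MvPolynomial (Fin n ⊕ Fin p) K) {Λ : Set (Fin p)}
    {j : Fin p} (hj : j ∈ Λ) : MFam f Λ (Sum.inr j) = mulOp (X (Sum.inr j) - f j) :=
  if_pos hj

omit [CharZero K] in
theorem MFam_inr_of_notMem (f : Fin p → MvPolynomial (Fin n ⊕ Fin p) K) {Λ : Set (Fin p)}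
    {j : Fin p} (hj : j ∉ Λ) : MFam f Λ (Sum.inr j) = sigmaOp f j :=
  if_neg hj

theorem MvPolynomial.pderiv_comm {R σ : Type*} [CommRing R] (v w : σ) (q : MvPolynomial σ R) :
    pderiv v (pderiv w q) = pderiv w (pderiv v q) := by
  classical
  have h : ⁅pderiv (R := R) v, pderiv (R := R) w⁆ = 0 := by
    refine derivation_ext fun i => ?_
    rw [Derivation.commutator_apply]
    simp only [pderiv_X, Pi.single_apply]
    split_ifs <;> simp
  have := DFunLike.congr_fun h q
  rwa [Derivation.commutator_apply, Derivation.zero_apply, sub_eq_zero] at this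

omit [CharZero K] in
theorem commute_pd_pd (v w : Fin n ⊕ Fin p) :
    Commute (pd v : Module.End K (MvPolynomial (Fin n ⊕ Fin p) K)) (pd w) :=
  LinearMap.ext fun q => MvPolynomial.pderiv_comm v w q

omit [CharZero K] in
theorem commute_mulOp_mulOp (g h : MvPolynomial (Fin n ⊕ Fin p) K) :
    Commute (mulOp g) (mulOp h) :=
  LinearMap.ext fun q => mul_left_comm g h q

omit [CharZero K] in
theorem commute_mulOp_pd {v : Fin n ⊕ Fin p} {g : MvPolynomial (Fin n ⊕ Fin p) K}
    (hg : pderiv v g = 0) : Commute (mulOp g) (pd v) :=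
  LinearMap.ext fun q => by simp [mulOp_apply, pd_apply, hg]

omit [CharZero K] in
theorem commute_MFam_zero (Λ : Set (Fin p)) (a b : Fin n ⊕ Fin p) :
    Commute (MFam (0 : Fin p → MvPolynomial (Fin n ⊕ Fin p) K) Λ a) (MFam 0 Λ b) := by
  have hX {v w : Fin n ⊕ Fin p} (h : v ≠ w) :
      pderiv w (X v : MvPolynomial (Fin n ⊕ Fin p) K) = 0 := pderiv_X_of_ne h
  have hX' {v w : Fin n ⊕ Fin p} (h : v ≠ w) :
      pderiv w (-X v : MvPolynomial (Fin n ⊕ Fin p) K) = 0 := by rw [map_neg, hX h, neg_zero]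
  have hxt (i : Fin n) (j : Fin p) :
      Commute (MFam (0 : Fin p → MvPolynomial (Fin n ⊕ Fin p) K) Λ (Sum.inl i))
        (MFam 0 Λ (Sum.inr j)) := by
    rw [MFam_inl, gOp_zero]
    by_cases hj : j ∈ Λ
    · rw [MFam_inr_of_mem _ hj, Pi.zero_apply, sub_zero]
      exact (commute_mulOp_pd (hX (by simp))).symm
    · rw [MFam_inr_of_notMem _ hj, sigmaOp, Pi.zero_apply, zero_sub]
      exact ((commute_mulOp_pd (hX' (by simp))).symm.mul_right
        (commute_pd_pd _ _)).sub_right (Commute.one_right _)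
  have hms {j k : Fin p} (hjk : j ≠ k) :
      Commute (mulOp (X (Sum.inr j) : MvPolynomial (Fin n ⊕ Fin p) K)) (sigmaOp 0 k) := by
    rw [sigmaOp]
    exact ((commute_mulOp_mulOp _ _).mul_right
      (commute_mulOp_pd (hX (by simpa using hjk)))).sub_right (Commute.one_right _)
  rcases a with i | j <;> rcases b with i' | k
  · rw [MFam_inl, MFam_inl, gOp_zero, gOp_zero]
    exact commute_pd_pd _ _
  · exact hxt i k
  · exact (hxt i' j).symm
  · obtain rfl | hjk := eq_or_ne j k
    · exact Commute.refl _
    by_cases hj : j ∈ Λ <;> by_cases hk : k ∈ Λ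
    · rw [MFam_inr_of_mem _ hj, MFam_inr_of_mem _ hk]
      exact commute_mulOp_mulOp _ _
    · rw [MFam_inr_of_mem _ hj, MFam_inr_of_notMem _ hk, Pi.zero_apply, sub_zero]
      exact hms hjk
    · rw [MFam_inr_of_notMem _ hj, MFam_inr_of_mem _ hk, Pi.zero_apply, sub_zero]
      exact (hms hjk.symm).symm
    · rw [MFam_inr_of_notMem _ hj, MFam_inr_of_notMem _ hk, sigmaOp, sigmaOp, Pi.zero_apply,
        Pi.zero_apply, zero_sub, zero_sub]
      refine Commute.sub_left (Commute.sub_right ?_ (Commute.one_right _)) (Commute.one_left _)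
      refine Commute.mul_left (Commute.mul_right (commute_mulOp_mulOp _ _) ?_)
        (Commute.mul_right ?_ (commute_pd_pd _ _))
      · exact commute_mulOp_pd (hX' (by simpa using hjk))
      · exact (commute_mulOp_pd (hX' (by simpa using hjk.symm))).symm

/-- The `K`-algebra endomorphism of `K[x,t]` fixing the `x_i` and sending `t_j` to `t_j + f_j`. -/
noncomputable def shiftT (f : Fin p → MvPolynomial (Fin n ⊕ Fin p) K) :
    MvPolynomial (Fin n ⊕ Fin p) K →ₐ[K] MvPolynomial (Fin n ⊕ Fin p) K :=
  aeval (Sum.elim (fun i => X (Sum.inl i)) fun j => X (Sum.inr j) + f j)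

omit [CharZero K] in
theorem shiftT_X_inl (f : Fin p → MvPolynomial (Fin n ⊕ Fin p) K) (i : Fin n) :
    shiftT f (X (Sum.inl i)) = X (Sum.inl i) := by simp [shiftT]

omit [CharZero K] in
theorem shiftT_X_inr (f : Fin p → MvPolynomial (Fin n ⊕ Fin p) K) (j : Fin p) :
    shiftT f (X (Sum.inr j)) = X (Sum.inr j) + f j := by simp [shiftT]

omit [CharZero K] in
theorem shiftT_eq_self (f : Fin p → MvPolynomial (Fin n ⊕ Fin p) K)
    {g : MvPolynomial (Fin n ⊕ Fin p) K} (hg : g ∈ supported K (Set.range Sum.inl)) :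
    shiftT f g = g := by
  refine AlgHom.adjoin_le_equalizer (shiftT f) (AlgHom.id K _) ?_ hg
  rintro _ ⟨_, ⟨i, rfl⟩, rfl⟩
  exact shiftT_X_inl f i

omit [CharZero K] in
theorem shiftT_comp_shiftT_neg (f : Fin p → MvPolynomial (Fin n ⊕ Fin p) K)
    (hf : ∀ j, f j ∈ supported K (Set.range Sum.inl)) :
    (shiftT f).comp (shiftT (-f)) = AlgHom.id K _ := by
  refine algHom_ext fun v => ?_
  rcases v with i | j
  · simp [shiftT_X_inl]
  · simp [shiftT_X_inr, shiftT_eq_self f (hf j)]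

/-- The automorphism of `K[x,t]` fixing the `x_i` and sending `t_j` to `t_j - f_j`. -/
noncomputable def shiftEquiv (f : Fin p → MvPolynomial (Fin n ⊕ Fin p) K)
    (hf : ∀ j, f j ∈ supported K (Set.range Sum.inl)) :
    MvPolynomial (Fin n ⊕ Fin p) K ≃ₐ[K] MvPolynomial (Fin n ⊕ Fin p) K :=
  AlgEquiv.ofAlgHom (shiftT (-f)) (shiftT f)
    (by simpa using shiftT_comp_shiftT_neg (-f) fun j => neg_mem (hf j))
    (shiftT_comp_shiftT_neg f hf)

omit [CharZero K] in
theorem pderiv_inr_eq_zero {g : MvPolynomial (Fin n ⊕ Fin p) K}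
    (hg : g ∈ supported K (Set.range Sum.inl)) (j : Fin p) : pderiv (Sum.inr j) g = 0 :=
  pderiv_eq_zero_of_notMem_vars fun h => by simpa using mem_supported.1 hg h

omit [CharZero K] in
theorem pderiv_inr_shiftT {f : Fin p → MvPolynomial (Fin n ⊕ Fin p) K}
    (hf : ∀ j, f j ∈ supported K (Set.range Sum.inl)) (j : Fin p)
    (q : MvPolynomial (Fin n ⊕ Fin p) K) :
    pderiv (Sum.inr j) (shiftT f q) = shiftT f (pderiv (Sum.inr j) q) := by
  induction q using MvPolynomial.induction_on with
  | C c => simp [shiftT]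
  | add q r hq hr => simp [hq, hr]
  | mul_X q v hq =>
    rcases v with i | k
    · simp [hq, shiftT_X_inl]
    · simp only [map_mul, Derivation.leibniz, smul_eq_mul, map_add, hq, shiftT_X_inr,
        pderiv_inr_eq_zero (hf k), add_zero]
      obtain rfl | h := eq_or_ne k j
      · simp
      · simp [pderiv_X_of_ne (show (Sum.inr k : Fin n ⊕ Fin p) ≠ Sum.inr j by simpa using h)]

omit [CharZero K] in
theorem pderiv_inl_shiftT {f : Fin p → MvPolynomial (Fin n ⊕ Fin p) K} (i : Fin n)
    (q : MvPolynomial (Fin n ⊕ Fin p) K) :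
    pderiv (Sum.inl i) (shiftT f q) = shiftT f (pderiv (Sum.inl i) q)
      + ∑ j, pderiv (Sum.inl i) (f j) * shiftT f (pderiv (Sum.inr j) q) := by
  classical
  induction q using MvPolynomial.induction_on with
  | C c => simp [shiftT]
  | add q r hq hr => simp only [map_add, hq, hr, mul_add, Finset.sum_add_distrib]; ring
  | mul_X q v hq =>
    rcases v with k | k
    · simp only [map_mul, Derivation.leibniz, smul_eq_mul, map_add, hq, shiftT_X_inl, pderiv_X,
        Pi.single_apply, reduceCtorEq, if_false, mul_zero, zero_add, mul_add,
        Finset.mul_sum, mul_left_comm (X _)]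
      split_ifs <;> simp [add_assoc]
    · simp only [map_mul, Derivation.leibniz, smul_eq_mul, map_add, hq, shiftT_X_inr, pderiv_X,
        Pi.single_apply, reduceCtorEq, if_false, map_zero, mul_zero, zero_add, mul_add,
        Finset.sum_add_distrib, Sum.inr.injEq, apply_ite (shiftT f), mul_ite, mul_one,
        Finset.sum_ite_eq, Finset.mem_univ, if_true, add_mul,
        Finset.mul_sum, mul_left_comm (X _), mul_left_comm (f k)]
      ring

omit [CharZero K] in
theorem MFam_shiftEquiv {f : Fin p → MvPolynomial (Fin n ⊕ Fin p) K}
    (hf : ∀ j, f j ∈ supported K (Set.range Sum.inl)) (Λ : Set (Fin p)) (a : Fin n ⊕ Fin p)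
    (q : MvPolynomial (Fin n ⊕ Fin p) K) :
    MFam f Λ a (shiftEquiv f hf q) = shiftEquiv f hf (MFam 0 Λ a q) := by
  have hf' : ∀ j, (-f) j ∈ supported K (Set.range Sum.inl) := fun j => neg_mem (hf j)
  change MFam f Λ a (shiftT (-f) q) = shiftT (-f) (MFam 0 Λ a q)
  rcases a with i | j
  · rw [MFam_inl, MFam_inl, gOp_zero, pd_apply, gOp_apply, pderiv_inl_shiftT]
    simp [pderiv_inr_shiftT hf']
  · by_cases hj : j ∈ Λ
    · rw [MFam_inr_of_mem _ hj, MFam_inr_of_mem _ hj, mulOp_apply, mulOp_apply]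
      simp [shiftT_X_inr, sub_eq_add_neg]
    · rw [MFam_inr_of_notMem _ hj, MFam_inr_of_notMem _ hj, sigmaOp_apply, sigmaOp_apply,
        pderiv_inr_shiftT hf']
      simp only [Pi.zero_apply, map_sub, map_mul, map_zero, shiftT_X_inr, Pi.neg_apply]
      ring

theorem Finsupp.prod_factorial_eq {ι : Type*} [Fintype ι] (a : ι →₀ ℕ) {i : ι} (hi : a i ≠ 0) :
    ∏ k, (a k).factorial = a i * ∏ k, ((a - single i 1 : ι →₀ ℕ) k).factorial := by
  classical
  rw [Fintype.prod_eq_mul_prod_compl i, Fintype.prod_eq_mul_prod_compl i, ← mul_assoc]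
  congr 1
  · simpa using (Nat.mul_factorial_pred hi).symm
  · refine Finset.prod_congr rfl fun k hk => ?_
    have hk : i ≠ k := by simpa [eq_comm] using hk
    simp [Finsupp.single_eq_of_ne' hk]

/-- Applying `Ψ P` to `x^a t^β` and evaluating at `x = 0`, `t = c` reads off `a!` times the
coefficient of `x^a` in `P`, evaluated at `y`. -/
theorem eval_algHom_monomial {Λ : Set (Fin p)}
    {Ψ : MvPolynomial (Fin n ⊕ Fin p) K →ₐ[K] Module.End K (MvPolynomial (Fin n ⊕ Fin p) K)}
    (hΨ : ∀ a, Ψ (X a) = MFam 0 Λ a) {β : Fin p →₀ ℕ} {c y : Fin p → K}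
    (hβ : ∀ j, β j ≠ 0 → c j = 1) (hc : ∀ j ∈ Λ, y j = c j)
    (hy : ∀ j ∉ Λ, y j = -(β j : K) - 1)
    (P : MvPolynomial (Fin n ⊕ Fin p) K) (a : Fin n →₀ ℕ) :
    eval (Sum.elim 0 c) (Ψ P (monomial (Finsupp.sumElim a β) 1)) =
      (∏ k, (a k).factorial : ℕ) * eval y (coeff a (sumAlgEquiv K (Fin n) (Fin p) P)) := by
  classical
  induction P using MvPolynomial.induction_on generalizing a with
  | C r =>
    have h : Ψ (C r) = algebraMap K _ r := Ψ.commutes r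
    rw [h, Module.algebraMap_end_apply, sumAlgEquiv_C_inl, coeff_C, smul_eval, eval_monomial,
      Finsupp.prod_fintype _ _ (by simp), Fintype.prod_sum_type]
    have hβ' : ∏ j, c j ^ β j = 1 := Finset.prod_eq_one fun j _ => by
      by_cases h : β j = 0
      · simp [h]
      · simp [hβ j h]
    by_cases ha : 0 = a
    · subst ha
      simp [hβ']
    · obtain ⟨i, hi⟩ : ∃ i, a i ≠ 0 := by
        by_contra! h
        exact ha (Finsupp.ext h).symm
      simp [ha, Finset.prod_eq_zero (Finset.mem_univ i), hi]
  | add P Q hP hQ => simp only [map_add, LinearMap.add_apply, coeff_add, hP, hQ, mul_add]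
  | mul_X P v hP =>
    rcases v with i | j
    · rw [map_mul, Module.End.mul_apply, hΨ, MFam_inl, gOp_zero, pd_apply, pderiv_monomial,
        map_mul (sumAlgEquiv K _ _), sumAlgEquiv_X_inl, coeff_mul_X']
      have hsub : Finsupp.sumElim a β - Finsupp.single (Sum.inl i) 1 =
          Finsupp.sumElim (a - Finsupp.single i 1) β := by
        ext (k | k) <;> simp [Finsupp.single_apply]
      have hsmul : monomial (Finsupp.sumElim a β - Finsupp.single (Sum.inl i) 1)
          (1 * (Finsupp.sumElim a β (Sum.inl i) : K)) =
          (a i : K) • monomial (Finsupp.sumElim (a - Finsupp.single i 1) β) (1 : K) := by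
        rw [hsub, smul_monomial]; simp
      rw [hsmul, map_smul, smul_eval, hP]
      by_cases hi : a i = 0
      · simp [hi]
      · rw [if_pos (Finsupp.mem_support_iff.2 hi), Finsupp.prod_factorial_eq a hi, Nat.cast_mul,
          mul_assoc]
    · have hcoeff : eval y (coeff a (sumAlgEquiv K (Fin n) (Fin p) (P * X (Sum.inr j)))) =
          y j * eval y (coeff a (sumAlgEquiv K (Fin n) (Fin p) P)) := by
        rw [map_mul, sumAlgEquiv_X_inr, mul_comm, coeff_C_mul, map_mul, eval_X]
      rw [hcoeff]
      by_cases hj : j ∈ Λ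
      · rw [mul_comm P, map_mul, Module.End.mul_apply, hΨ, MFam_inr_of_mem _ hj, mulOp_apply,
          map_mul, hP, hc j hj]
        simp [mul_left_comm]
      · have hsmul : sigmaOp 0 j (monomial (Finsupp.sumElim a β) (1 : K)) =
            y j • monomial (Finsupp.sumElim a β) (1 : K) := by
          rw [sigmaOp_apply, Pi.zero_apply, zero_sub, neg_mul, X_mul_pderiv_monomial, hy j hj,
            sub_smul, neg_smul, one_smul, Nat.cast_smul_eq_nsmul]
          rfl
        rw [map_mul, Module.End.mul_apply, hΨ, MFam_inr_of_notMem _ hj, hsmul, map_smul,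
          smul_eval, hP, mul_left_comm]

theorem injective_of_map_X_eq_MFam_zero {Λ : Set (Fin p)}
    {Ψ : MvPolynomial (Fin n ⊕ Fin p) K →ₐ[K] Module.End K (MvPolynomial (Fin n ⊕ Fin p) K)}
    (hΨ : ∀ a, Ψ (X a) = MFam 0 Λ a) : Function.Injective Ψ := by
  classical
  refine (injective_iff_map_eq_zero Ψ).2 fun P hP => ?_
  rw [← map_eq_zero_iff _ (sumAlgEquiv K (Fin n) (Fin p)).injective]
  ext1 a
  rw [coeff_zero]
  let S : Fin p → Set K := fun j => if j ∈ Λ then Set.univ else Set.range fun b : ℕ => -(b : K) - 1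
  have hS : ∀ j, (S j).Infinite := fun j => by
    by_cases hj : j ∈ Λ
    · simpa only [S, if_pos hj] using Set.infinite_univ
    · simp only [S, if_neg hj]
      exact Set.infinite_range_of_injective fun b b' h => by simpa using h
  refine funext_set S hS fun y hy => ?_
  have hex : ∀ j, ∃ b : ℕ, (j ∈ Λ → b = 0) ∧ (j ∉ Λ → y j = -(b : K) - 1) := fun j => by
    by_cases hj : j ∈ Λ
    · exact ⟨0, by simp [hj]⟩
    · have := hy j trivial
      simp only [S, if_neg hj] at this
      obtain ⟨b, hb⟩ := this
      exact ⟨b, by simp [hj], fun _ => hb.symm⟩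
  choose b hb0 hb using hex
  have h := eval_algHom_monomial hΨ (β := Finsupp.equivFunOnFinite.symm b)
    (c := fun j => if j ∈ Λ then y j else 1) (y := y)
    (fun j hj => if_neg fun h => hj (hb0 j h)) (fun j hj => (if_pos hj).symm) hb P a
  rw [hP, LinearMap.zero_apply, map_zero, eq_comm, mul_eq_zero] at h
  rw [map_zero]
  exact h.resolve_left (Nat.cast_ne_zero.2 (Finset.prod_ne_zero_iff.2
    fun k _ => Nat.factorial_ne_zero _))

/-- Theorem (Section 3.3, parts (c) and (d)): for every `Λ ⊆ {1,…,p}` there is an injective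
`K`-algebra homomorphism from the polynomial ring in `n + p` variables to `End_K(R)` sending
the variables to the members of `M_Λ`, whose range is the subalgebra generated by `M_Λ`.
Consequently the members of `M_Λ` are algebraically independent over `K` and generate a
subalgebra isomorphic to a commutative polynomial ring in `n + p` variables. -/
theorem MFam_algebraicallyIndependent (hn : 0 < n) (hp : 0 < p)
    (f : Fin p → MvPolynomial (Fin n ⊕ Fin p) K)
    (hf : ∀ j, f j ∈ MvPolynomial.supported K (Set.range Sum.inl))
    (Λ : Set (Fin p)) :
    ∃ Φ : MvPolynomial (Fin n ⊕ Fin p) K →ₐ[K]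
        Module.End K (MvPolynomial (Fin n ⊕ Fin p) K),
      Function.Injective Φ ∧
      (∀ a : Fin n ⊕ Fin p, Φ (X a) = MFam f Λ a) ∧
      Φ.range = Algebra.adjoin K (Set.range (MFam f Λ)) := by
  obtain ⟨Ψ, hΨ⟩ := exists_algHom_of_commute (R := K)
    (MFam (0 : Fin p → MvPolynomial (Fin n ⊕ Fin p) K) Λ) (commute_MFam_zero Λ)
  let e := (shiftEquiv f hf).toLinearEquiv.conjAlgEquiv K
  have hΦ : ∀ a, (e.toAlgHom.comp Ψ) (X a) = MFam f Λ a := fun a => by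
    refine LinearMap.ext fun q => ?_
    change shiftEquiv f hf (Ψ (X a) ((shiftEquiv f hf).symm q)) = _
    rw [hΨ, ← MFam_shiftEquiv, AlgEquiv.apply_symm_apply]
  exact ⟨e.toAlgHom.comp Ψ, e.injective.comp (injective_of_map_X_eq_MFam_zero hΨ), hΦ,
    range_eq_adjoin_of_map_X hΦ⟩
end

section
/- (Third-order homogeneous recurrence for ζ, Section 7.4.) For all real numbers a, b, setting A := a² − a and B := b² − b, for every natural number m: A·B·(m+1)·ζ(m) − ((m+2)·(A+B) − (4m+6)·A·B)·ζ(m+1) − ((4m+10)·(A+B) − (m+3))·ζ(m+2) + (4m+14)·ζ(m+3) = 0. -/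
/-- Integrating the derivative of `(2x - 1)(x² - x)^(m+1)` gives an inhomogeneous first-order
recurrence for the integrals of `(x² - x)^m`. -/
theorem integral_sq_sub_self_pow_recurrence (a b : ℝ) (m : ℕ) :
    (4 * (m : ℝ) + 6) * (∫ x in a..b, (x ^ 2 - x) ^ (m + 1)) +
        ((m : ℝ) + 1) * (∫ x in a..b, (x ^ 2 - x) ^ m) =
      (2 * b - 1) * (b ^ 2 - b) ^ (m + 1) - (2 * a - 1) * (a ^ 2 - a) ^ (m + 1) := by
  have hint (k : ℕ) (c : ℝ) :
      IntervalIntegrable (fun x : ℝ => c * (x ^ 2 - x) ^ k) MeasureTheory.volume a b :=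
    Continuous.intervalIntegrable (by fun_prop) a b
  have hderiv (x : ℝ) : HasDerivAt (fun x : ℝ => (2 * x - 1) * (x ^ 2 - x) ^ (m + 1))
      ((4 * (m : ℝ) + 6) * (x ^ 2 - x) ^ (m + 1) + ((m : ℝ) + 1) * (x ^ 2 - x) ^ m) x := by
    have hlin : HasDerivAt (fun x : ℝ => 2 * x - 1) (2 * 1) x :=
      ((hasDerivAt_id' x).const_mul 2).sub_const 1
    have hpow := (((hasDerivAt_pow 2 x).fun_sub (hasDerivAt_id' x)).fun_pow (m + 1))
    refine (hlin.fun_mul hpow).congr_deriv ?_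
    simp only [Nat.add_sub_cancel]
    push_cast
    ring
  rw [← intervalIntegral.integral_const_mul, ← intervalIntegral.integral_const_mul,
    ← intervalIntegral.integral_add (hint _ _) (hint _ _)]
  exact intervalIntegral.integral_eq_sub_of_hasDerivAt (fun x _ => hderiv x)
    ((hint _ _).add (hint _ _))

/-- Third-order homogeneous recurrence for `ζ(m) = ∫_a^b (x² − x)^m dx` (Section 7.4):
with `A = a² − a` and `B = b² − b`,
`A·B·(m+1)·ζ(m) − ((m+2)(A+B) − (4m+6)·A·B)·ζ(m+1)
  − ((4m+10)(A+B) − (m+3))·ζ(m+2) + (4m+14)·ζ(m+3) = 0`. -/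
theorem zeta_third_order_recurrence (a b : ℝ) (m : ℕ) :
    (a ^ 2 - a) * (b ^ 2 - b) * ((m : ℝ) + 1) * (∫ x in a..b, (x ^ 2 - x) ^ m) -
        (((m : ℝ) + 2) * ((a ^ 2 - a) + (b ^ 2 - b)) -
            (4 * (m : ℝ) + 6) * ((a ^ 2 - a) * (b ^ 2 - b))) *
          (∫ x in a..b, (x ^ 2 - x) ^ (m + 1)) -
        ((4 * (m : ℝ) + 10) * ((a ^ 2 - a) + (b ^ 2 - b)) - ((m : ℝ) + 3)) *
          (∫ x in a..b, (x ^ 2 - x) ^ (m + 2)) +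
        (4 * (m : ℝ) + 14) * (∫ x in a..b, (x ^ 2 - x) ^ (m + 3)) = 0 := by
  have h₀ := integral_sq_sub_self_pow_recurrence a b m
  have h₁ := integral_sq_sub_self_pow_recurrence a b (m + 1)
  have h₂ := integral_sq_sub_self_pow_recurrence a b (m + 2)
  push_cast at h₁ h₂
  linear_combination h₂ - ((a ^ 2 - a) + (b ^ 2 - b)) * h₁ + (a ^ 2 - a) * (b ^ 2 - b) * h₀
end
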